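/- Let d ≥ 2 be an even integer and q ∈ ℂ with q ≠ 0 and q ≠ −1. If (q+1)^d = 1 + dq and 2(1+q)^d = d(d−1)q² + dq + 2 + d(1+q)^(d−1)q, then q = −2 and (−1)^d = 1 − 2d. -/

import Mathlib

/-- For even `d ≥ 2` and `q ∈ ℂ` with `q ≠ 0`, `q ≠ −1`, if
`(q+1)^d = 1 + dq` and `2(1+q)^d = d(d−1)q² + dq + 2 + d(1+q)^(d−1)q`, then
`q = −2` and `(−1)^d = 1 − 2d`. -/
theorem stmt5 (d : ℕ) (hd : 2 ≤ d) (hde : Even d) (q : ℂ) (hq : q ≠ 0) (hq' : q ≠ -1)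
    (h1 : (q + 1)^d = 1 + (d : ℂ) * q)
    (h2 : 2*(1+q)^d = (d : ℂ)*((d : ℂ)-1)*q^2 + (d : ℂ)*q + 2 + (d : ℂ)*(1+q)^(d-1)*q) :
    q = -2 ∧ (-1 : ℂ)^d = 1 - 2*(d : ℂ) := by
  have hd0 : (d : ℂ) ≠ 0 := by
    exact_mod_cast (by omega : d ≠ 0)
  have hd1 : (d : ℂ) - 1 ≠ 0 := by
    rw [sub_ne_zero]
    exact_mod_cast (by omega : d ≠ 1)
  have hx : (1 + q)^d = (1 + q)^(d-1) * (1 + q) := by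
    rw [← pow_succ]
    congr 1
    omega
  rw [add_comm q 1] at h1
  rw [h1] at h2 hx
  have e1 : (1 + q)^(d-1) = 1 - ((d : ℂ) - 1) * q := by
    apply mul_left_cancel₀ (mul_ne_zero hd0 hq)
    linear_combination -h2
  rw [e1] at hx
  have e2 : q = -2 := by
    apply mul_left_cancel₀ (mul_ne_zero hd1 hq)
    linear_combination hx
  refine ⟨e2, ?_⟩
  rw [e2] at h1
  have e3 : (1 + -2 : ℂ) = -1 := by norm_num
  rw [e3] at h1
  rw [h1]
  ring
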